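/- (ODE blow-up with N-function nonlinearity, λ = 1) Let α, β > 0 and let N : [0,∞) → [0,∞) satisfy N(p), N'(p) > 0 for p > 0 and N(p) ≍ p^{1+α} for 0 ≤ p ≤ 1, N(p) ≍ p^{1+β} for p > 1. Suppose I ∈ C²([0,T);ℝ) satisfies I''(t) + I'(t) ≥ c (1+t)^{-1} N(I(t)) for all t ∈ [0,T) with some c > 0, and I(0) = ε > 0, I'(0) ≥ 0. Then if ε is small enough, T is finite and T ≤ exp(C ε^{-α}) for a constant C depending only on α, β, c. -/

import Mathlib

open Real Set

/-- At the left end point the two-sided `deriv` carries the sign of the one-sided derivative,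
as soon as the second-order expression `deriv (deriv f) a + deriv f a` is positive. -/
lemma derivWithin_Ico_nonneg_of_deriv_nonneg {f : ℝ → ℝ} {a b : ℝ} (hab : a < b)
    (hf : ContinuousWithinAt (derivWithin f (Ico a b)) (Ico a b) a)
    (h₁ : 0 ≤ deriv f a) (h₂ : 0 < deriv (deriv f) a + deriv f a) :
    0 ≤ derivWithin f (Ico a b) a := by
  have ha : a ∈ Ico a b := ⟨le_rfl, hab⟩
  by_cases hd : DifferentiableAt ℝ f a
  · rwa [hd.derivWithin (uniqueDiffOn_Ico a b a ha)]
  · have h0 : deriv f a = 0 := deriv_zero_of_not_differentiableAt hd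
    have hdd : DifferentiableAt ℝ (deriv f) a := by
      by_contra hdd
      rw [h0, deriv_zero_of_not_differentiableAt hdd] at h₂
      simp at h₂
    have hl : Filter.Tendsto (derivWithin f (Ico a b)) (nhdsWithin a (Ioo a b))
        (nhds (derivWithin f (Ico a b) a)) :=
      hf.mono_left (nhdsWithin_mono a Ioo_subset_Ico_self)
    have hr : Filter.Tendsto (derivWithin f (Ico a b)) (nhdsWithin a (Ioo a b))
        (nhds (deriv f a)) := by
      refine (hdd.continuousAt.tendsto.mono_left nhdsWithin_le_nhds).congr' ?_
      filter_upwards [self_mem_nhdsWithin] with x hx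
      exact (derivWithin_of_mem_nhds (Ico_mem_nhds hx.1 hx.2)).symm
    have : (nhdsWithin a (Ioo a b)).NeBot := left_nhdsWithin_Ioo_neBot hab
    rw [tendsto_nhds_unique hl hr, h0]

lemma pos_and_deriv_nonneg_of_second_order {f : ℝ → ℝ} {T : ℝ}
    (hf : ContDiffOn ℝ 2 f (Ico 0 T))
    (hineq : ∀ t ∈ Ico (0 : ℝ) T, 0 < f t → 0 < deriv (deriv f) t + deriv f t)
    (h0 : 0 < f 0) (h1 : 0 ≤ deriv f 0) :
    ∀ t ∈ Ioo (0 : ℝ) T, f 0 ≤ f t ∧ 0 ≤ deriv f t := by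
  intro t₀ ht₀
  have hT : 0 < T := ht₀.1.trans ht₀.2
  have hcw : ContinuousOn (derivWithin f (Ico 0 T)) (Ico 0 T) :=
    hf.continuousOn_derivWithin (uniqueDiffOn_Ico 0 T) (by norm_num)
  have hz : (0 : ℝ) ∈ Ico 0 T := ⟨le_rfl, hT⟩
  have hw0 := derivWithin_Ico_nonneg_of_deriv_nonneg hT (hcw 0 hz) h1 (hineq 0 hz h0)
  have heq : ∀ t ∈ Ioo (0 : ℝ) T, derivWithin f (Ico 0 T) t = deriv f t := fun t ht ↦
    derivWithin_of_mem_nhds (Ico_mem_nhds ht.1 ht.2)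
  have hdd : DifferentiableOn ℝ (deriv f) (Ioo 0 T) :=
    ((hf.mono Ioo_subset_Ico_self).deriv_of_isOpen (m := 1) isOpen_Ioo
      (by norm_num)).differentiableOn (by norm_num)
  have key : ∀ b, 0 < b → b < T → (∀ t ∈ Ico 0 b, 0 < f t) → f 0 ≤ f b ∧ 0 ≤ deriv f b := by
    intro b hb hbT hpos
    have hsub : Icc 0 b ⊆ Ico 0 T := fun x hx ↦ ⟨hx.1, hx.2.trans_lt hbT⟩
    have hsub' : Ioo 0 b ⊆ Ioo 0 T := fun x hx ↦ ⟨hx.1, hx.2.trans hbT⟩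
    have hmono : MonotoneOn (fun t ↦ exp t * derivWithin f (Ico 0 T) t) (Icc 0 b) := by
      have hder : ∀ t ∈ Ioo 0 b, HasDerivAt (fun t ↦ exp t * derivWithin f (Ico 0 T) t)
          (exp t * deriv f t + exp t * deriv (deriv f) t) t := by
        intro t ht
        have h := (Real.hasDerivAt_exp t).mul
          ((hdd t (hsub' ht)).differentiableAt (Ioo_mem_nhds ht.1 (hsub' ht).2)).hasDerivAt
        refine h.congr_of_eventuallyEq ?_
        filter_upwards [Ioo_mem_nhds ht.1 (hsub' ht).2] with x hx
        simp [heq x hx]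
      refine monotoneOn_of_deriv_nonneg (convex_Icc 0 b)
        (Real.continuous_exp.continuousOn.mul (hcw.mono hsub)) ?_ ?_
      · rw [interior_Icc]
        exact fun t ht ↦ (hder t ht).differentiableAt.differentiableWithinAt
      · rw [interior_Icc]
        intro t ht
        rw [(hder t ht).deriv, ← mul_add, add_comm]
        exact mul_nonneg (exp_pos t).le
          (hineq t (Ioo_subset_Ico_self (hsub' ht)) (hpos t (Ioo_subset_Ico_self ht))).le
    have hnn : ∀ t ∈ Ioc 0 b, 0 ≤ deriv f t := by
      intro t ht
      have h := hmono ⟨le_rfl, hb.le⟩ (Ioc_subset_Icc_self ht) ht.1.le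
      simp only [exp_zero, one_mul, heq t ⟨ht.1, ht.2.trans_lt hbT⟩] at h
      exact nonneg_of_mul_nonneg_right (hw0.trans h) (exp_pos t)
    refine ⟨?_, hnn b ⟨hb, le_rfl⟩⟩
    have hm : MonotoneOn f (Icc 0 b) := by
      refine monotoneOn_of_deriv_nonneg (convex_Icc 0 b) (hf.continuousOn.mono hsub) ?_ ?_
      · rw [interior_Icc]
        exact (hf.differentiableOn (by norm_num)).mono (Ioo_subset_Icc_self.trans hsub)
      · rw [interior_Icc]
        exact fun t ht ↦ hnn t (Ioo_subset_Ioc_self ht)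
    exact hm ⟨le_rfl, hb.le⟩ ⟨hb.le, le_rfl⟩ hb.le
  refine key t₀ ht₀.1 ht₀.2 fun t ht ↦ ?_
  by_contra hneg
  have hsubt : Icc 0 t ⊆ Ico 0 T := fun x hx ↦ ⟨hx.1, hx.2.trans_lt (ht.2.trans ht₀.2)⟩
  have hcomp : IsCompact (Icc 0 t ∩ f ⁻¹' Iic 0) :=
    isCompact_Icc.of_isClosed_subset
      ((hf.continuousOn.mono hsubt).preimage_isClosed_of_isClosed isClosed_Icc isClosed_Iic)
      inter_subset_left
  obtain ⟨s, ⟨hsI, hs0⟩, hmin⟩ := hcomp.exists_isLeast ⟨t, ⟨ht.1, le_rfl⟩, not_lt.1 hneg⟩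
  have hs0' : f s ≤ 0 := hs0
  have hspos : 0 < s := by
    rcases hsI.1.lt_or_eq with h | h
    · exact h
    · rw [← h] at hs0'
      linarith
  have := (key s hspos (hsubt hsI).2 fun x hx ↦ by
    by_contra hx0
    exact (hmin ⟨⟨hx.1, hx.2.le.trans hsI.2⟩, not_lt.1 hx0⟩).not_gt hx.2).1
  linarith

/-- Pointwise bounds comparing the growth of `N` with the first two derivatives of
`p ↦ p ^ (-α) + p ^ (-b)`. -/
lemma exists_growth_bounds {α b c k₁ k₂ : ℝ} (hb : 0 < b) (hbα : b ≤ α) (hc : 0 < c)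
    (hk₁ : 0 < k₁) (hk₂ : 0 < k₂) {N : ℝ → ℝ}
    (hlow : ∀ p : ℝ, 0 < p → p ≤ 1 → k₁ * p ^ (1 + α) ≤ N p)
    (hhigh : ∀ p : ℝ, 1 < p → k₂ * p ^ (1 + 2 * b) ≤ N p) :
    ∃ m M : ℝ, 0 < m ∧ 0 < M ∧ ∀ p : ℝ, 0 < p → ∃ K : ℝ, 1 ≤ K ∧
      m * K ≤ c * ((α * p ^ (-α - 1) + b * p ^ (-b - 1)) * N p) ∧
      α * (α + 1) * p ^ (-α - 2) + b * (b + 1) * p ^ (-b - 2) ≤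
        M * K * (α * p ^ (-α - 1) + b * p ^ (-b - 1)) ^ 2 := by
  have hα : 0 < α := hb.trans_le hbα
  set S := α * (α + 1) + b * (b + 1) with hS
  have hSpos : 0 < S := by positivity
  refine ⟨c * (b * min k₁ k₂), S / b ^ 2, by positivity, by positivity, fun p hp ↦ ?_⟩
  have hN : ∀ {a K q k n : ℝ}, 0 ≤ K → b ≤ a → min k₁ k₂ ≤ k → 0 ≤ q → 0 ≤ n →
      q * n = K → a * q ≤ α * p ^ (-α - 1) + b * p ^ (-b - 1) → k * n ≤ N p →
      c * (b * min k₁ k₂) * K ≤ c * ((α * p ^ (-α - 1) + b * p ^ (-b - 1)) * N p) := by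
    intro a K q k n hK hba hk hq hn hqn hle hkn
    have hm0 : 0 < min k₁ k₂ := lt_min hk₁ hk₂
    have hk0 : 0 < k := hm0.trans_le hk
    have ha0 : 0 < a := hb.trans_le hba
    calc c * (b * min k₁ k₂) * K ≤ c * (a * k) * K := by gcongr
      _ = c * ((a * q) * (k * n)) := by rw [← hqn]; ring
      _ ≤ _ := by gcongr
  have hsq : ∀ {x q K : ℝ}, 0 ≤ q → p ^ (-α - 2) ≤ x → p ^ (-b - 2) ≤ x → x ≤ K * q ^ 2 →
      0 ≤ K → b * q ≤ α * p ^ (-α - 1) + b * p ^ (-b - 1) →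
      α * (α + 1) * p ^ (-α - 2) + b * (b + 1) * p ^ (-b - 2) ≤
        S / b ^ 2 * K * (α * p ^ (-α - 1) + b * p ^ (-b - 1)) ^ 2 := by
    intro x q K hq h1 h2 hx hK hle
    calc α * (α + 1) * p ^ (-α - 2) + b * (b + 1) * p ^ (-b - 2)
        ≤ α * (α + 1) * x + b * (b + 1) * x := by gcongr
      _ = S * x := by rw [hS]; ring
      _ ≤ S * (K * q ^ 2) := by gcongr
      _ = S / b ^ 2 * K * (b * q) ^ 2 := by field_simp
      _ ≤ _ := by gcongr
  have hA : 0 < p ^ (-α - 1) := rpow_pos_of_pos hp _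
  have hB : 0 < p ^ (-b - 1) := rpow_pos_of_pos hp _
  rcases le_or_gt p 1 with h1 | h1
  · refine ⟨1, le_rfl, ?_, ?_⟩
    · refine hN (a := α) (q := p ^ (-α - 1)) (n := p ^ (1 + α)) zero_le_one hbα
        (min_le_left _ _) hA.le (rpow_nonneg hp.le _) ?_ ?_ (hlow p hp h1)
      · rw [← rpow_add hp]
        ring_nf
        exact rpow_zero p
      · have : 0 < b * p ^ (-b - 1) := by positivity
        linarith
    · refine hsq (x := p ^ (-α - 2)) (q := p ^ (-α - 1)) hA.le le_rfl ?_ ?_ zero_le_one ?_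
      · exact rpow_le_rpow_of_exponent_ge hp h1 (by linarith)
      · rw [one_mul, ← rpow_natCast, ← rpow_mul hp.le]
        exact rpow_le_rpow_of_exponent_ge hp h1 (by push_cast; linarith)
      · have h2 : 0 < b * p ^ (-b - 1) := by positivity
        have h3 : b * p ^ (-α - 1) ≤ α * p ^ (-α - 1) := by gcongr
        linarith
  · have hle : b * p ^ (-b - 1) ≤ α * p ^ (-α - 1) + b * p ^ (-b - 1) := by
      have : 0 < α * p ^ (-α - 1) := by positivity
      linarith
    have hK : 0 ≤ p ^ b := rpow_nonneg hp.le _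
    refine ⟨p ^ b, one_le_rpow h1.le hb.le, ?_, ?_⟩
    · refine hN (a := b) (q := p ^ (-b - 1)) (n := p ^ (1 + 2 * b)) hK le_rfl
        (min_le_right _ _) hB.le (rpow_nonneg hp.le _) ?_ hle (hhigh p h1)
      rw [← rpow_add hp]
      ring_nf
    · refine hsq (x := p ^ (-b - 2)) (q := p ^ (-b - 1)) hB.le ?_ le_rfl ?_ hK hle
      · exact rpow_le_rpow_of_exponent_le h1.le (by linarith)
      · rw [← rpow_natCast, ← rpow_mul hp.le, ← rpow_add hp]
        exact rpow_le_rpow_of_exponent_le h1.le (by push_cast; linarith)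

/-- A Riccati-type differential inequality forces `v` above the barrier
`δ * (t - 1) / (1 + t) ^ 2`. -/
lemma barrier_le_of_riccati {v v' : ℝ → ℝ} {m M δ T : ℝ} (hM : 0 < M) (hδ : 0 < δ)
    (hδ1 : δ ≤ 1) (hδm : (2 + M) * δ < m)
    (hv : ∀ t ∈ Ico 1 T, HasDerivAt v (v' t) t) (hv1 : 0 ≤ v 1)
    (hineq : ∀ t ∈ Ico 1 T, ∃ K : ℝ, 1 ≤ K ∧ K * (m * (1 + t)⁻¹ - M * v t ^ 2) ≤ v' t + v t) :
    ∀ t ∈ Ico 1 T, δ * ((t - 1) / (1 + t) ^ 2) ≤ v t := by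
  intro t ht
  have hsub : ∀ x ∈ Icc 1 t, x ∈ Ico 1 T := fun x hx ↦ ⟨hx.1, hx.2.trans_lt ht.2⟩
  have hφ : ∀ x : ℝ, 1 ≤ x → HasDerivAt (fun t : ℝ ↦ δ * ((t - 1) / (1 + t) ^ 2))
      (δ * ((3 - x) / (1 + x) ^ 3)) x := by
    intro x hx
    have hx0 : (1 + x) ≠ 0 := by positivity
    have h := (((hasDerivAt_id x).sub_const 1).div
      (((hasDerivAt_id x).const_add 1).pow 2) (pow_ne_zero 2 hx0)).const_mul δ
    refine h.congr_deriv ?_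
    simp only [id, Pi.pow_apply]
    field_simp
    ring
  refine image_le_of_deriv_right_lt_deriv_boundary' (a := 1) (b := t)
    (f := fun t : ℝ ↦ δ * ((t - 1) / (1 + t) ^ 2)) (f' := fun x ↦ δ * ((3 - x) / (1 + x) ^ 3))
    (B := v) (B' := v')
    (fun x hx ↦ (hφ x hx.1).continuousAt.continuousWithinAt)
    (fun x hx ↦ (hφ x hx.1).hasDerivWithinAt) (by simpa using hv1)
    (fun x hx ↦ (hv x (hsub x hx)).continuousAt.continuousWithinAt)
    (fun x hx ↦ (hv x (hsub x (Ico_subset_Icc_self hx))).hasDerivWithinAt)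
    ?_ ⟨ht.1, le_rfl⟩
  intro x hx hxv
  obtain ⟨K, hK, hKle⟩ := hineq x (hsub x (Ico_subset_Icc_self hx))
  have hx1 : 1 ≤ x := hx.1
  set y := (1 + x)⁻¹ with hy
  have hy0 : 0 < y := by positivity
  have hy1 : y ≤ 1 := inv_le_one_of_one_le₀ (by linarith)
  have hφv : v x ≤ δ * y := by
    rw [← hxv, hy, ← one_div]
    gcongr δ * ?_
    rw [div_le_div_iff₀ (by positivity) (by positivity)]
    nlinarith
  have hv0 : 0 ≤ v x := by
    rw [← hxv]
    have : 0 ≤ x - 1 := by linarith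
    positivity
  have hd : δ * ((3 - x) / (1 + x) ^ 3) ≤ δ * y := by
    rw [hy, ← one_div]
    gcongr δ * ?_
    rw [div_le_div_iff₀ (by positivity) (by positivity)]
    nlinarith [mul_nonneg (sub_nonneg.2 hx1) (sq_nonneg x)]
  have hsq : v x ^ 2 ≤ δ * y := by
    calc v x ^ 2 ≤ (δ * y) ^ 2 := by gcongr
      _ = (δ * y) * (δ * y) := sq _
      _ ≤ (δ * y) * 1 := by gcongr; nlinarith
      _ = δ * y := mul_one _
  have hMs : M * v x ^ 2 ≤ M * (δ * y) := by gcongr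
  have hmy : (2 + M) * δ * y < m * y := by gcongr
  have hpos : 0 ≤ m * y - M * v x ^ 2 := by nlinarith [mul_pos hδ hy0]
  have hbig : m * y - M * v x ^ 2 ≤ K * (m * y - M * v x ^ 2) := le_mul_of_one_le_left hpos hK
  show δ * ((3 - x) / (1 + x) ^ 3) < v' x
  nlinarith

lemma log_le_of_barrier {u u' : ℝ → ℝ} {δ t : ℝ} (ht : 1 ≤ t)
    (hu : ∀ s ∈ Icc 1 t, HasDerivAt u (u' s) s) (hu0 : 0 ≤ u t)
    (hle : ∀ s ∈ Icc 1 t, δ * ((s - 1) / (1 + s) ^ 2) ≤ -u' s) (hδ : 0 < δ) :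
    δ * log t ≤ u 1 + 2 * δ := by
  have hder : ∀ s ∈ Icc 1 t, HasDerivAt (fun s ↦ u s + δ * (log (1 + s) + 2 * (1 + s)⁻¹))
      (u' s + δ * ((s - 1) / (1 + s) ^ 2)) s := by
    intro s hs
    have hs0 : 1 + s ≠ 0 := by linarith [hs.1]
    have h1 := (hasDerivAt_id s).const_add 1
    have h := (hu s hs).add
      (((h1.log hs0).add ((h1.inv hs0).const_mul 2)).const_mul δ)
    refine h.congr_deriv ?_
    simp only [id]
    field_simp
    ring
  have hanti : AntitoneOn (fun s ↦ u s + δ * (log (1 + s) + 2 * (1 + s)⁻¹)) (Icc 1 t) := by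
    refine antitoneOn_of_deriv_nonpos (convex_Icc 1 t)
      (fun s hs ↦ (hder s hs).continuousAt.continuousWithinAt) ?_ ?_
    · exact fun s hs ↦ (hder s (interior_subset hs)).differentiableAt.differentiableWithinAt
    · intro s hs
      rw [(hder s (interior_subset hs)).deriv]
      linarith [hle s (interior_subset hs)]
  have h := hanti ⟨le_rfl, ht⟩ ⟨ht, le_rfl⟩ ht
  simp only at h
  have hlog : log t ≤ log (1 + t) := log_le_log (by linarith) (by linarith)
  have hinv : 0 < (1 + t)⁻¹ := by positivity
  have hlog2 : log (1 + 1) ≤ 1 := by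
    have := log_le_sub_one_of_pos (show (0 : ℝ) < 1 + 1 by norm_num)
    linarith
  have h1 : δ * log t ≤ δ * (log (1 + t) + 2 * (1 + t)⁻¹) := by
    gcongr
    linarith
  have h2 : δ * (log (1 + 1) + 2 * (1 + 1)⁻¹) ≤ δ * 2 := by
    gcongr
    norm_num at hlog2 ⊢
    linarith
  linarith

lemma hasDerivAt_rpow_neg_comp {f : ℝ → ℝ} {f' t : ℝ} (a : ℝ) (hf : HasDerivAt f f' t)
    (hpos : 0 < f t) :
    HasDerivAt (fun s ↦ f s ^ (-a)) (-(a * f t ^ (-a - 1) * f')) t := by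
  convert hf.rpow_const (p := -a) (Or.inl hpos.ne') using 1
  ring

/-- ODE blow-up with N-function nonlinearity, λ = 1 (Lemma 4 of Lai–Schiavone). -/
theorem stmt_14 (α β c : ℝ) (hα : 0 < α) (hβ : 0 < β) (hc : 0 < c)
    (N : ℝ → ℝ)
    (hNpos : ∀ p : ℝ, 0 < p → 0 < N p ∧ 0 < deriv N p)
    (hNlow : ∃ k₁ k₂ : ℝ, 0 < k₁ ∧ 0 < k₂ ∧ ∀ p : ℝ, 0 ≤ p → p ≤ 1 →
        k₁ * p ^ (1 + α) ≤ N p ∧ N p ≤ k₂ * p ^ (1 + α))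
    (hNhigh : ∃ k₁ k₂ : ℝ, 0 < k₁ ∧ 0 < k₂ ∧ ∀ p : ℝ, 1 < p →
        k₁ * p ^ (1 + β) ≤ N p ∧ N p ≤ k₂ * p ^ (1 + β)) :
    ∃ ε₀ C : ℝ, 0 < ε₀ ∧ 0 < C ∧
      ∀ ε : ℝ, 0 < ε → ε ≤ ε₀ →
        ∀ (T : ℝ) (I : ℝ → ℝ),
          ContDiffOn ℝ 2 I (Ico 0 T) →
          (∀ t ∈ Ico (0 : ℝ) T,
              c * (1 + t)⁻¹ * N (I t) ≤ deriv (deriv I) t + deriv I t) →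
          I 0 = ε → 0 ≤ deriv I 0 →
          (0 : ℝ) < T →
          T ≤ exp (C * ε ^ (-α)) := by
  obtain ⟨k₁, _, hk₁, _, hlow⟩ := hNlow
  obtain ⟨k₂, _, hk₂, _, hhigh⟩ := hNhigh
  set b := min α (β / 2)
  have hb : 0 < b := lt_min hα (by linarith)
  have hbα : b ≤ α := min_le_left _ _
  have hbβ : b ≤ β / 2 := min_le_right _ _
  obtain ⟨m, M, hm, hM, hgrow⟩ := exists_growth_bounds (N := N) hb hbα hc hk₁ hk₂
    (fun p hp h1 ↦ (hlow p hp.le h1).1)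
    (fun p h1 ↦ le_trans (by gcongr; exacts [h1.le, by linarith]) (hhigh p h1).1)
  obtain ⟨δ, hδ, hδ1, hδm⟩ : ∃ δ : ℝ, 0 < δ ∧ δ ≤ 1 ∧ (2 + M) * δ < m := by
    refine ⟨min 1 (m / (2 + M) / 2), by positivity, min_le_left _ _, ?_⟩
    calc (2 + M) * min 1 (m / (2 + M) / 2) ≤ (2 + M) * (m / (2 + M) / 2) := by
          gcongr
          exact min_le_right _ _
      _ = m / 2 := by field_simp
      _ < m := by linarith
  refine ⟨1, 2 / δ + 2, one_pos, by positivity, ?_⟩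
  intro ε hε hε1 T I hI hode hI0 hI1 hT
  have hεα : 1 ≤ ε ^ (-α) := one_le_rpow_of_pos_of_le_one_of_nonpos hε hε1 (by linarith)
  have hCε : 0 ≤ (2 / δ + 2) * ε ^ (-α) := by positivity
  have hbase := pos_and_deriv_nonneg_of_second_order hI
    (fun t ht hpos ↦ lt_of_lt_of_le
      (mul_pos (mul_pos hc (inv_pos.2 (by linarith [ht.1]))) (hNpos _ hpos).1) (hode t ht))
    (hI0 ▸ hε) hI1
  rw [hI0] at hbase
  have hIoo : ∀ t ∈ Ico 1 T, t ∈ Ioo 0 T := fun t ht ↦ ⟨one_pos.trans_le ht.1, ht.2⟩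
  have hpos : ∀ t ∈ Ico 1 T, 0 < I t := fun t ht ↦ hε.trans_le (hbase t (hIoo t ht)).1
  have hI' : ∀ t ∈ Ico 1 T, HasDerivAt I (deriv I t) t := fun t ht ↦
    ((hI.differentiableOn (by norm_num)).differentiableAt
      (Ico_mem_nhds (hIoo t ht).1 ht.2)).hasDerivAt
  have hI'' : ∀ t ∈ Ico 1 T, HasDerivAt (deriv I) (deriv (deriv I) t) t := fun t ht ↦
    ((((hI.mono Ioo_subset_Ico_self).deriv_of_isOpen (m := 1) isOpen_Ioo
      (by norm_num)).differentiableOn (by norm_num)).differentiableAt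
      (Ioo_mem_nhds (hIoo t ht).1 ht.2)).hasDerivAt
  set q : ℝ → ℝ := fun t ↦ α * I t ^ (-α - 1) + b * I t ^ (-b - 1) with hq
  set r : ℝ → ℝ := fun t ↦ α * (α + 1) * I t ^ (-α - 2) + b * (b + 1) * I t ^ (-b - 2) with hr
  have hu : ∀ t ∈ Ico 1 T, HasDerivAt (fun s ↦ I s ^ (-α) + I s ^ (-b)) (-(q t * deriv I t)) t := by
    intro t ht
    refine ((hasDerivAt_rpow_neg_comp α (hI' t ht) (hpos t ht)).add
      (hasDerivAt_rpow_neg_comp b (hI' t ht) (hpos t ht))).congr_deriv ?_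
    simp only [hq]
    ring
  have hq' : ∀ t ∈ Ico 1 T, HasDerivAt q (-(r t * deriv I t)) t := by
    intro t ht
    have h : ∀ a : ℝ, HasDerivAt (fun s ↦ a * I s ^ (-a - 1))
        (-(a * (a + 1) * I t ^ (-a - 2) * deriv I t)) t := by
      intro a
      have h := (hasDerivAt_rpow_neg_comp (a + 1) (hI' t ht) (hpos t ht)).const_mul a
      rw [show -(a + 1) = -a - 1 by ring] at h
      refine h.congr_deriv ?_
      rw [show -a - 1 - 1 = -a - 2 by ring]
      ring
    refine ((h α).add (h b)).congr_deriv ?_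
    simp only [hr]
    ring
  have hq0 : ∀ t ∈ Ico 1 T, 0 < q t := by
    intro t ht
    have := hpos t ht
    positivity
  have hbar := barrier_le_of_riccati (v := fun t ↦ q t * deriv I t)
    (v' := fun t ↦ -(r t * deriv I t) * deriv I t + q t * deriv (deriv I) t)
    (T := T) hM hδ hδ1 hδm (fun t ht ↦ (hq' t ht).mul (hI'' t ht))
  have hlog : ∀ t ∈ Ico 1 T, δ * log t ≤ 2 * ε ^ (-α) + 2 * δ := by
    intro t ht
    have h1T : (1 : ℝ) ∈ Ico 1 T := ⟨le_rfl, ht.1.trans_lt ht.2⟩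
    have hsub : ∀ s ∈ Icc 1 t, s ∈ Ico 1 T := fun s hs ↦ ⟨hs.1, hs.2.trans_lt ht.2⟩
    have hv := hbar (mul_nonneg (hq0 1 h1T).le (hbase 1 (hIoo 1 h1T)).2) ?_
    · have h := log_le_of_barrier ht.1 (fun s hs ↦ hu s (hsub s hs))
        (by have := hpos t ht; positivity)
        (fun s hs ↦ by simpa using hv s (hsub s hs)) hδ
      have hI1ε := (hbase 1 (hIoo 1 h1T)).1
      have hα1 : I 1 ^ (-α) ≤ ε ^ (-α) := rpow_le_rpow_of_nonpos hε hI1ε (by linarith)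
      have hb1 : I 1 ^ (-b) ≤ ε ^ (-α) := (rpow_le_rpow_of_nonpos hε hI1ε (by linarith)).trans
        (rpow_le_rpow_of_exponent_ge hε hε1 (by linarith))
      linarith
    · intro s hs
      obtain ⟨K, hK, hmK, hMK⟩ := hgrow (I s) (hpos s hs)
      refine ⟨K, hK, ?_⟩
      have hy : 0 < (1 + s)⁻¹ := inv_pos.2 (by linarith [hs.1])
      have hmK' := mul_le_mul_of_nonneg_right hmK hy.le
      have hMK' : r s * deriv I s ^ 2 ≤ M * K * q s ^ 2 * deriv I s ^ 2 :=
        mul_le_mul_of_nonneg_right hMK (sq_nonneg _)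
      have hode' := mul_le_mul_of_nonneg_left
        (hode s (Ioo_subset_Ico_self (hIoo s hs))) (hq0 s hs).le
      have hmK'' : m * K * (1 + s)⁻¹ ≤ c * (q s * N (I s)) * (1 + s)⁻¹ := hmK'
      show K * (m * (1 + s)⁻¹ - M * (q s * deriv I s) ^ 2) ≤
        -(r s * deriv I s) * deriv I s + q s * deriv (deriv I) s + q s * deriv I s
      linarith
  refine le_of_forall_lt_imp_le_of_dense fun t htT ↦ ?_
  rcases le_or_gt t 1 with h1 | h1
  · exact h1.trans (one_le_exp hCε)
  · rw [← log_le_iff_le_exp (by linarith)]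
    have h := hlog t ⟨h1.le, htT⟩
    calc log t ≤ (2 * ε ^ (-α) + 2 * δ) / δ := by
          rw [le_div_iff₀ hδ]
          linarith
      _ = 2 / δ * ε ^ (-α) + 2 * 1 := by field_simp
      _ ≤ 2 / δ * ε ^ (-α) + 2 * ε ^ (-α) := by gcongr
      _ = _ := by ring
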